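/- Let d ≥ 1. Let C be a real symmetric positive semidefinite d×d matrix with eigendecomposition C = U Λ Uᵀ, where U is orthogonal and Λ = diag(λ₁, …, λ_d) with λ₁ ≥ ⋯ ≥ λ_d ≥ 0, and let E = diag(μ₁, …, μ_d) with 0 ≤ μ₁ ≤ ⋯ ≤ μ_d. Then the minimum of tr(Rᵀ C R E) over all real orthogonal d×d matrices R equals the minimum of tr(Πᵀ Λ Π E) over all d×d permutation matrices Π. -/

import Mathlib

open Matrix Finset

/-- For diagonal `Λ` and `E`, `tr(Zᵀ Λ Z E)` depends only on the squared entries of `Z`. -/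
lemma trace_transpose_mul_diagonal_mul_mul_diagonal {n : Type*} [Fintype n] [DecidableEq n]
    (Z : Matrix n n ℝ) (a b : n → ℝ) :
    (Zᵀ * Matrix.diagonal a * Z * Matrix.diagonal b).trace
      = a ⬝ᵥ ((Z ⊙ Z) *ᵥ b) := by
  simp only [Matrix.trace, Matrix.diag_apply, Matrix.mul_diagonal,
    Matrix.mul_apply (M := Zᵀ * Matrix.diagonal a), Matrix.transpose_apply, dotProduct,
    Matrix.mulVec, Matrix.hadamard_apply, Finset.sum_mul, Finset.mul_sum]
  rw [Finset.sum_comm]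
  exact Finset.sum_congr rfl fun i _ => Finset.sum_congr rfl fun j _ => by ring

lemma permMatrix_hadamard_self {n : Type*} [DecidableEq n] (σ : Equiv.Perm n) :
    σ.permMatrix ℝ ⊙ σ.permMatrix ℝ = σ.permMatrix ℝ := by
  ext i j
  simp [Equiv.Perm.permMatrix, PEquiv.toMatrix_apply]

lemma permMatrix_transpose_mul_self {n : Type*} [Fintype n] [DecidableEq n]
    (σ : Equiv.Perm n) : (σ.permMatrix ℝ)ᵀ * σ.permMatrix ℝ = 1 := by
  rw [Matrix.transpose_permMatrix, ← Matrix.permMatrix_mul]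
  simp

lemma hadamard_self_mem_doublyStochastic {n : Type*} [Fintype n] [DecidableEq n]
    {Z : Matrix n n ℝ} (hZ : Zᵀ * Z = 1) : Z ⊙ Z ∈ doublyStochastic ℝ n := by
  have hZ' : Z * Zᵀ = 1 := mul_eq_one_comm.mp hZ
  rw [mem_doublyStochastic_iff_sum]
  refine ⟨fun i j => mul_self_nonneg _, fun i => ?_, fun j => ?_⟩
  · simpa [Matrix.mul_apply] using congrArg (fun M => M i i) hZ'
  · simpa [Matrix.mul_apply] using congrArg (fun M => M j j) hZ

/-- A linear functional bounded below on permutation matrices is bounded below by the same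
constant on doubly stochastic matrices. -/
lemma le_of_mem_doublyStochastic {n : Type*} [Fintype n] [DecidableEq n]
    (f : Matrix n n ℝ →ₗ[ℝ] ℝ) {c : ℝ} (hc : ∀ σ : Equiv.Perm n, c ≤ f (σ.permMatrix ℝ))
    {M : Matrix n n ℝ} (hM : M ∈ doublyStochastic ℝ n) : c ≤ f M := by
  obtain ⟨w, hw0, hw1, rfl⟩ := exists_eq_sum_perm_of_mem_doublyStochastic hM
  simp only [map_sum, map_smul, smul_eq_mul]
  calc c = ∑ σ, w σ * c := by rw [← Finset.sum_mul, hw1, one_mul]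
    _ ≤ _ := Finset.sum_le_sum fun σ _ => mul_le_mul_of_nonneg_left (hc σ) (hw0 σ)

lemma exists_permMatrix_le_trace {n : Type*} [Fintype n] [DecidableEq n] (a b : n → ℝ) :
    ∃ σ : Equiv.Perm n, ∀ Z : Matrix n n ℝ, Zᵀ * Z = 1 →
      ((σ.permMatrix ℝ)ᵀ * Matrix.diagonal a * σ.permMatrix ℝ * Matrix.diagonal b).trace
        ≤ (Zᵀ * Matrix.diagonal a * Z * Matrix.diagonal b).trace := by
  let f : Matrix n n ℝ →ₗ[ℝ] ℝ :=
    { toFun := fun M => a ⬝ᵥ (M *ᵥ b)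
      map_add' := fun M N => by rw [Matrix.add_mulVec, dotProduct_add]
      map_smul' := fun r M => by rw [Matrix.smul_mulVec, dotProduct_smul]; rfl }
  obtain ⟨σ, hσ⟩ := Finite.exists_min fun σ : Equiv.Perm n => f (σ.permMatrix ℝ)
  refine ⟨σ, fun Z hZ => ?_⟩
  rw [trace_transpose_mul_diagonal_mul_mul_diagonal,
    trace_transpose_mul_diagonal_mul_mul_diagonal, permMatrix_hadamard_self]
  exact le_of_mem_doublyStochastic f hσ (hadamard_self_mem_doublyStochastic hZ)

/-- The minimum of `tr(Rᵀ C R E)` over orthogonal `R` equals the minimum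
of `tr(Πᵀ Λ Π E)` over permutation matrices `Π`, where `C = U Λ Uᵀ`. -/
theorem orthogonal_min_eq_permutation_min (d : ℕ) (hd : 1 ≤ d)
    (C U : Matrix (Fin d) (Fin d) ℝ) (lam mu : Fin d → ℝ)
    (hC : C.PosSemidef)
    (hU : Uᵀ * U = 1)
    (hdecomp : C = U * Matrix.diagonal lam * Uᵀ)
    (hlam : ∀ i j : Fin d, i ≤ j → lam j ≤ lam i)
    (hlam0 : ∀ i, 0 ≤ lam i)
    (hmu : ∀ i j : Fin d, i ≤ j → mu i ≤ mu j)
    (hmu0 : ∀ i, 0 ≤ mu i) :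
    ∃ m : ℝ,
      IsLeast {x : ℝ | ∃ R : Matrix (Fin d) (Fin d) ℝ, Rᵀ * R = 1 ∧
          x = (Rᵀ * C * R * Matrix.diagonal mu).trace} m ∧
      IsLeast {x : ℝ | ∃ σ : Equiv.Perm (Fin d),
          x = ((σ.permMatrix ℝ)ᵀ * Matrix.diagonal lam * σ.permMatrix ℝ
                * Matrix.diagonal mu).trace} m := by
  obtain ⟨σ, hσ⟩ := exists_permMatrix_le_trace lam mu
  have hU' : U * Uᵀ = 1 := mul_eq_one_comm.mp hU
  refine ⟨_, ⟨⟨U * σ.permMatrix ℝ, ?_, ?_⟩, ?_⟩, ⟨σ, rfl⟩, ?_⟩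
  · rw [Matrix.transpose_mul, Matrix.mul_assoc, ← Matrix.mul_assoc Uᵀ, hU, Matrix.one_mul,
      permMatrix_transpose_mul_self]
  · have h : (U * σ.permMatrix ℝ)ᵀ * C * (U * σ.permMatrix ℝ)
        = (σ.permMatrix ℝ)ᵀ * (Uᵀ * U) * Matrix.diagonal lam * (Uᵀ * U) * σ.permMatrix ℝ := by
      rw [hdecomp, Matrix.transpose_mul]
      simp only [Matrix.mul_assoc]
    rw [h, hU, Matrix.mul_one, Matrix.mul_one]
  · rintro x ⟨R, hR, rfl⟩
    have hZ : (Uᵀ * R)ᵀ * (Uᵀ * R) = 1 := by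
      rw [Matrix.transpose_mul, Matrix.transpose_transpose, Matrix.mul_assoc,
        ← Matrix.mul_assoc U, hU', Matrix.one_mul, hR]
    have h : Rᵀ * C * R = (Uᵀ * R)ᵀ * Matrix.diagonal lam * (Uᵀ * R) := by
      rw [hdecomp, Matrix.transpose_mul, Matrix.transpose_transpose]
      simp only [Matrix.mul_assoc]
    rw [h]
    exact hσ _ hZ
  · rintro x ⟨τ, rfl⟩
    exact hσ _ (permMatrix_transpose_mul_self τ)
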